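/- arXiv:1509.05621 — 2 statements merged into one kernel-verified Lean document; each statement's English description precedes it below -/
import Mathlib

section
/- If a complete edge-colored graph has no colorful 4-cycle and no colorful 5-cycle, then it has no colorful n-cycle for any n > 3. -/
def IsColorfulCycle {V Γ : Type*} (col : V → V → Γ) (n : ℕ) : Prop :=
  ∃ v : ZMod n → V, Function.Injective v ∧
    Function.Injective (fun i : ZMod n => col (v i) (v (i + 1)))

lemma colorful_iff {V Γ : Type*} (col : V → V → Γ) (n : ℕ) (hn : 1 < n) :
    IsColorfulCycle col n ↔ ∃ f : ℕ → V, f n = f 0 ∧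
      (∀ i j, i < j → j < n → f i ≠ f j) ∧
      (∀ i j, i < j → j < n → col (f i) (f (i + 1)) ≠ col (f j) (f (j + 1))) := by
  have : NeZero n := ⟨by omega⟩
  have key : ∀ i j : ℕ, i < j → j < n → (i : ZMod n) ≠ (j : ZMod n) := by
    intro i j hij hj h
    have h2 := congrArg ZMod.val h
    rw [ZMod.val_natCast_of_lt (by omega), ZMod.val_natCast_of_lt hj] at h2
    omega
  constructor
  · rintro ⟨v, hv, hc⟩
    refine ⟨fun i => v (i : ZMod n), by simp, ?_, ?_⟩
    · intro i j hij hj h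
      exact key i j hij hj (hv h)
    · intro i j hij hj h
      refine key i j hij hj (hc ?_)
      simpa using h
  · rintro ⟨f, h0, hf, hc⟩
    have hs : ∀ i : ZMod n, f (i + 1).val = f (i.val + 1) := by
      intro i
      have : Fact (1 < n) := ⟨hn⟩
      have hi := ZMod.val_lt i
      rw [ZMod.val_add, ZMod.val_one]
      rcases Nat.lt_or_ge (i.val + 1) n with h | h
      · rw [Nat.mod_eq_of_lt h]
      · have h' : i.val + 1 = n := by omega
        rw [h', Nat.mod_self, h0]
    refine ⟨fun i => f i.val, ?_, ?_⟩
    · intro i j h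
      apply ZMod.val_injective n
      rcases Nat.lt_trichotomy i.val j.val with h1 | h1 | h1
      · exact absurd h (hf _ _ h1 (ZMod.val_lt j))
      · exact h1
      · exact absurd h.symm (hf _ _ h1 (ZMod.val_lt i))
    · intro i j h
      simp only [hs] at h
      apply ZMod.val_injective n
      rcases Nat.lt_trichotomy i.val j.val with h1 | h1 | h1
      · exact absurd h (hc _ _ h1 (ZMod.val_lt j))
      · exact h1
      · exact absurd h.symm (hc _ _ h1 (ZMod.val_lt i))

lemma colorful_step {V Γ : Type*} (col : V → V → Γ)
    (hsymm : ∀ u v, col u v = col v u) (n : ℕ) (hn : 6 ≤ n)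
    (h4 : ¬ IsColorfulCycle col 4) (h : ¬ IsColorfulCycle col (n - 2)) :
    ¬ IsColorfulCycle col n := by
  rw [colorful_iff col 4 (by omega)] at h4
  rw [colorful_iff col (n - 2) (by omega)] at h
  rw [colorful_iff col n (by omega)]
  rintro ⟨f, h0, hf, hc⟩
  have A : ∃ k, k < 3 ∧ col (f 0) (f 3) = col (f k) (f (k + 1)) := by
    by_contra! hA
    refine h4 ⟨fun i => if i = 4 then f 0 else f i, by simp, ?_, ?_⟩
    · intro i j hij hj
      simp only [show i ≠ 4 by omega, show j ≠ 4 by omega, if_false]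
      exact hf i j hij (by omega)
    · intro i j hij hj
      simp only [show i ≠ 4 by omega, show j ≠ 4 by omega, show i + 1 ≠ 4 by omega, if_false]
      rcases Nat.lt_or_ge j 3 with h3 | h3
      · simp only [show j + 1 ≠ 4 by omega, if_false]
        exact hc i j hij (by omega)
      · obtain rfl : j = 3 := by omega
        simp only [if_true, Nat.reduceAdd]
        rw [hsymm (f 3)]
        exact (hA i hij).symm
  have B : ∃ k, 3 ≤ k ∧ k < n ∧ col (f 0) (f 3) = col (f k) (f (k + 1)) := by
    by_contra! hB
    refine h ⟨fun i => if i = 0 then f 0 else f (i + 2), ?_, ?_, ?_⟩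
    · simp only [show n - 2 ≠ 0 by omega, show n - 2 + 2 = n by omega, if_false, if_true, h0]
    · intro i j hij hj
      simp only [show j ≠ 0 by omega, if_false]
      split_ifs
      · exact hf _ _ (by omega) (by omega)
      · exact hf _ _ (by omega) (by omega)
    · intro i j hij hj
      simp only [show j ≠ 0 by omega, show j + 1 ≠ 0 by omega, show i + 1 ≠ 0 by omega, if_false]
      have e : ∀ i : ℕ, i + 1 + 2 = i + 2 + 1 := by omega
      rw [e, e]
      split_ifs with hi
      · subst hi
        exact hB (j + 2) (by omega) (by omega)
      · exact hc _ _ (by omega) (by omega)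
  obtain ⟨k, hk, ek⟩ := A
  obtain ⟨l, hl, hl', el⟩ := B
  exact hc k l (by omega) hl' (ek.symm.trans el)

/-- If a complete edge-colored graph has no colorful 4-cycle and no colorful 5-cycle,
then it has no colorful n-cycle for any n > 3. -/
theorem no_colorful_square_pentagon {V Γ : Type*} [Fintype V] (col : V → V → Γ)
    (hsymm : ∀ u v, col u v = col v u)
    (h4 : ¬ IsColorfulCycle col 4) (h5 : ¬ IsColorfulCycle col 5) :
    ∀ n : ℕ, 3 < n → ¬ IsColorfulCycle col n := by
  intro n
  induction n using Nat.strong_induction_on with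
  | _ n ih =>
    intro hn
    by_cases e4 : n = 4
    · subst e4; exact h4
    by_cases e5 : n = 5
    · subst e5; exact h5
    exact colorful_step col hsymm n (by omega) h4 (ih (n - 2) (by omega) (by omega))
end

section
/- Homomorphism duality for full homomorphisms: for every finite connected simple graph G, there is no full homomorphism from any of C_3 (the triangle), P_4 (the path with 5 vertices and 4 edges), or A (the 6-vertex graph with vertices v_0,…,v_5 and edges v_0v_1, v_1v_2, v_1v_4, v_2v_3, v_3v_4, v_4v_5) into G, if and only if there is a full homomorphism from G into C_5 (the 5-cycle). -/
/-- A full homomorphism between simple graphs: adjacency is both preserved and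
reflected. -/
def IsFullHom {V W : Type*} (G : SimpleGraph V) (H : SimpleGraph W) (f : V → W) : Prop :=
  ∀ u v, G.Adj u v ↔ H.Adj (f u) (f v)

/-- The graph A on vertices 0,…,5 with edges 01, 12, 14, 23, 34, 45. -/
def graphA : SimpleGraph (Fin 6) :=
  SimpleGraph.fromRel fun i j =>
    (i = 0 ∧ j = 1) ∨ (i = 1 ∧ j = 2) ∨ (i = 1 ∧ j = 4) ∨
    (i = 2 ∧ j = 3) ∨ (i = 3 ∧ j = 4) ∨ (i = 4 ∧ j = 5)

section helpers

variable {V : Type*} {G : SimpleGraph V}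

/-- Induced path on five vertices. -/
def NoPFive (G : SimpleGraph V) : Prop := ∀ a b c d e : V,
  G.Adj a b → G.Adj b c → G.Adj c d → G.Adj d e →
  ¬ G.Adj a c → ¬ G.Adj a d → ¬ G.Adj a e → ¬ G.Adj b d → ¬ G.Adj b e → ¬ G.Adj c e → False

/-- No triangle. -/
def NoTri (G : SimpleGraph V) : Prop := ∀ a b c : V,
  G.Adj a b → G.Adj b c → ¬ G.Adj a c

/-- No induced copy of the graph A (triangle-freeness covers the remaining non-edges). -/
def NoA (G : SimpleGraph V) : Prop := ∀ a b c d e f : V,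
  G.Adj a b → G.Adj b c → G.Adj b e → G.Adj c d → G.Adj d e → G.Adj e f →
  ¬ G.Adj a d → ¬ G.Adj a f → ¬ G.Adj c f → False

lemma noTri_of (h : ¬ ∃ f, IsFullHom (SimpleGraph.cycleGraph 3) G f) : NoTri G := by
  intro a b c h1 h2 h3
  apply h
  refine ⟨![a, b, c], ?_⟩
  have := h1.symm
  have := h2.symm
  have := h3.symm
  intro u v
  have key : (SimpleGraph.cycleGraph 3).Adj u v ↔ u ≠ v := by
    revert u v; decide
  rw [key]
  fin_cases u <;> fin_cases v <;> simp [*]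

lemma noPFive_of (h : ¬ ∃ f, IsFullHom (SimpleGraph.pathGraph 5) G f) : NoPFive G := by
  intro a b c d e h1 h2 h3 h4 n1 n2 n3 n4 n5 n6
  apply h
  refine ⟨![a, b, c, d, e], ?_⟩
  have := h1.symm
  have := h2.symm
  have := h3.symm
  have := h4.symm
  have m1 := mt G.adj_symm n1
  have m2 := mt G.adj_symm n2
  have m3 := mt G.adj_symm n3
  have m4 := mt G.adj_symm n4
  have m5 := mt G.adj_symm n5
  have m6 := mt G.adj_symm n6
  intro u v
  rw [SimpleGraph.pathGraph_adj]
  fin_cases u <;> fin_cases v <;> simp [*]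

lemma noA_of (ht : NoTri G) (h : ¬ ∃ f, IsFullHom graphA G f) : NoA G := by
  intro a b c d e f h1 h2 h3 h4 h5 h6 n1 n2 n3
  apply h
  refine ⟨![a, b, c, d, e, f], ?_⟩
  have k1 : ¬ G.Adj a c := ht _ _ _ h1 h2
  have k2 : ¬ G.Adj a e := ht _ _ _ h1 h3
  have k3 : ¬ G.Adj b d := ht _ _ _ h2 h4
  have k4 : ¬ G.Adj b f := ht _ _ _ h3 h6
  have k5 : ¬ G.Adj c e := ht _ _ _ h4 h5
  have k6 : ¬ G.Adj d f := ht _ _ _ h5 h6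
  have := h1.symm
  have := h2.symm
  have := h3.symm
  have := h4.symm
  have := h5.symm
  have := h6.symm
  have m1 := mt G.adj_symm n1
  have m2 := mt G.adj_symm n2
  have m3 := mt G.adj_symm n3
  have m4 := mt G.adj_symm k1
  have m5 := mt G.adj_symm k2
  have m6 := mt G.adj_symm k3
  have m7 := mt G.adj_symm k4
  have m8 := mt G.adj_symm k5
  have m9 := mt G.adj_symm k6
  intro u v
  fin_cases u <;> fin_cases v <;> simp [graphA, *]

lemma propagate (hG : G.Connected) (P : V → Prop) (r : V) (hr : P r)
    (hs : ∀ u v, G.Adj u v → P u → P v) (v : V) : P v := by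
  obtain ⟨w⟩ := hG.preconnected r v
  induction w with
  | nil => exact hr
  | cons h _ ih => exact ih (hs _ _ h hr)

/-- Build a full homomorphism from a total type assignment. -/
lemma build (T : Fin 5 → V → Prop) (hT : ∀ v, ∃ i, T i v)
    (hadj : ∀ i j u v, T i u → T j v → (G.Adj u v ↔ (SimpleGraph.cycleGraph 5).Adj i j)) :
    ∃ f, IsFullHom G (SimpleGraph.cycleGraph 5) f := by
  choose f hf using hT
  exact ⟨f, fun u v => hadj _ _ _ _ (hf u) (hf v)⟩

/-- The case of an induced five-cycle. -/
lemma case_five (hG : G.Connected) (ht : NoTri G) (hp : NoPFive G) (c : Fin 5 → V)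
    (hc : ∀ i, G.Adj (c i) (c (i + 1))) :
    ∃ f, IsFullHom G (SimpleGraph.cycleGraph 5) f := by
  have hn : ∀ i, ¬ G.Adj (c i) (c (i + 2)) := fun i =>
    ht _ (c (i + 1)) _ (hc i) (by have := hc (i + 1); rwa [add_assoc] at this)
  have sy : ∀ u v, G.Adj u v → G.Adj v u := fun _ _ h => h.symm
  have e0 := hc 0
  have e1 := hc 1
  have e2 := hc 2
  have e3 := hc 3
  have e4 := hc 4
  have n0 := hn 0
  have n1 := hn 1
  have n2 := hn 2
  have n3 := hn 3
  have n4 := hn 4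
  have shift : ∀ i : Fin 5, i + 1 + 1 = i + 2 ∧ i + 2 + 1 = i + 3 ∧ i + 3 + 1 = i + 4 ∧
    i + 4 + 1 = i ∧ i + 1 + 2 = i + 3 ∧ i + 2 + 2 = i + 4 ∧ i + 3 + 2 = i ∧ i + 4 + 2 = i + 1 := by
    decide
  let T : Fin 5 → V → Prop := fun i v => G.Adj v (c (i + 1)) ∧ G.Adj v (c (i + 4)) ∧
    ¬ G.Adj v (c i) ∧ ¬ G.Adj v (c (i + 2)) ∧ ¬ G.Adj v (c (i + 3))
  -- any vertex with a neighbour on the cycle has a type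
  have nb : ∀ i v, G.Adj v (c i) → ∃ j, T j v := by
    intro i v hv
    obtain ⟨s1, s2, s3, s4, s5, s6, s7, s8⟩ := shift i
    have a0 := hc i
    have a1 := hc (i + 1)
    have a2 := hc (i + 2)
    have a3 := hc (i + 3)
    have a4 := hc (i + 4)
    have b0 := hn i
    have b1 := hn (i + 1)
    have b2 := hn (i + 2)
    have b3 := hn (i + 3)
    have b4 := hn (i + 4)
    rw [s1] at a1
    rw [s2] at a2
    rw [s3] at a3
    rw [s4] at a4
    rw [s5] at b1
    rw [s6] at b2
    rw [s7] at b3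
    rw [s8] at b4
    have z1 := ht _ _ _ hv a0
    have z4 := ht _ _ _ hv a4.symm
    by_cases h2 : G.Adj v (c (i + 2))
    · have z3 := ht _ _ _ h2 a2
      refine ⟨i + 1, ?_⟩
      have : i + 1 + 4 = i ∧ i + 1 + 3 = i + 4 := by clear * -; revert i; decide
      simp only [T, s1, s5, this]
      exact ⟨h2, hv, z1, z3, z4⟩
    · by_cases h3 : G.Adj v (c (i + 3))
      · refine ⟨i + 4, ?_⟩
        have : i + 4 + 4 = i + 3 ∧ i + 4 + 3 = i + 2 := by clear * -; revert i; decide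
        simp only [T, s4, s8, this]
        exact ⟨hv, h3, z4, z1, h2⟩
      · exact (hp v (c i) (c (i + 1)) (c (i + 2)) (c (i + 3)) hv a0 a1 a2 z1 h2 h3 b0
          (fun h => b3 h.symm) b1).elim
  apply build T
  · apply propagate hG (fun v => ∃ j, T j v) (c 0)
    · exact nb 1 _ e0
    · rintro u v huv ⟨i, h1, h2, h3, h4, h5⟩
      by_contra hv
      have q : ∀ j, ¬ G.Adj v (c j) := fun j hj => hv (nb j v hj)
      obtain ⟨s1, s2, s3, s4, s5, s6, s7, s8⟩ := shift i
      have a1 := hc (i + 1)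
      have a2 := hc (i + 2)
      have b1 := hn (i + 1)
      rw [s1] at a1
      rw [s2] at a2
      rw [s5] at b1
      exact hp v u _ _ _ huv.symm h1 a1 a2 (q _) (q _) (q _) h4 h5 b1
  · intro i j u v hu hv
    have comm : ∀ k, G.Adj u (c k) → G.Adj v (c k) → ¬ G.Adj u v :=
      fun k h1 h2 => ht _ _ _ h1 h2.symm
    have step : ∀ i u v, T i u → T (i + 1) v → G.Adj u v := by
      intro i u v hu hv
      obtain ⟨s1, s2, s3, s4, s5, s6, s7, s8⟩ := shift i
      have : i + 1 + 4 = i ∧ i + 1 + 3 = i + 4 := by clear * -; revert i; decide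
      simp only [T, s1, s5, this] at hu hv
      have a2 := hc (i + 2)
      have a3 := hc (i + 3)
      have b2 := hn (i + 2)
      rw [s2] at a2
      rw [s3] at a3
      rw [s6] at b2
      by_contra hne
      exact hp u _ _ _ v hu.2.1 a3.symm a2.symm hv.1.symm hu.2.2.2.2 hu.2.2.2.1 hne
        (fun h => b2 h.symm) (fun h => hv.2.2.2.2 h.symm) (fun h => hv.2.2.2.1 h.symm)
    have cases5 : j = i ∨ j = i + 1 ∨ i = j + 1 ∨ j = i + 2 ∨ i = j + 2 := by
      clear * -; revert i j; decide
    have F1 : ∀ i : Fin 5, (SimpleGraph.cycleGraph 5).Adj i (i + 1) := by decide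
    have F2 : ∀ i : Fin 5, ¬ (SimpleGraph.cycleGraph 5).Adj i (i + 2) := by decide
    have s : ∀ i : Fin 5, i + 2 + 4 = i + 1 := by decide
    rcases cases5 with rfl | rfl | rfl | rfl | rfl
    · simp only [SimpleGraph.irrefl, iff_false]
      exact comm _ hu.1 hv.1
    · simp only [F1, iff_true]
      exact step _ _ _ hu hv
    · simp only [(F1 _).symm, iff_true]
      exact (step _ _ _ hv hu).symm
    · simp only [F2, iff_false]
      exact comm _ hu.1 (s i ▸ hv.2.1)
    · simp only [SimpleGraph.adj_comm _ (j + 2) j, F2, iff_false]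
      exact comm _ (s j ▸ hu.2.1) hv.1

/-- The case of an induced path on four vertices, without induced five-cycles. -/
lemma case_path (hG : G.Connected) (ht : NoTri G) (hp : NoPFive G) (hA : NoA G)
    (h5 : ∀ c : Fin 5 → V, ¬ ∀ i, G.Adj (c i) (c (i + 1)))
    (a b c d : V) (ab : G.Adj a b) (bc : G.Adj b c) (cd : G.Adj c d) (ad : ¬ G.Adj a d) :
    ∃ f, IsFullHom G (SimpleGraph.cycleGraph 5) f := by
  have sy : ∀ {u v}, G.Adj u v → G.Adj v u := fun h => h.symm
  have ns : ∀ {u v}, ¬ G.Adj u v → ¬ G.Adj v u := fun h k => h k.symm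
  have ac := ht _ _ _ ab bc
  have bd := ht _ _ _ bc cd
  let T : Fin 5 → V → Prop := ![
    fun v => ¬ G.Adj v a ∧ G.Adj v b ∧ ¬ G.Adj v c ∧ ¬ G.Adj v d,
    fun v => G.Adj v a ∧ ¬ G.Adj v b ∧ G.Adj v c ∧ ¬ G.Adj v d,
    fun v => ¬ G.Adj v a ∧ G.Adj v b ∧ ¬ G.Adj v c ∧ G.Adj v d,
    fun v => ¬ G.Adj v a ∧ ¬ G.Adj v b ∧ G.Adj v c ∧ ¬ G.Adj v d,
    fun _ => False]
  have nb : ∀ v, (G.Adj v a ∨ G.Adj v b ∨ G.Adj v c ∨ G.Adj v d) → ∃ j, T j v := by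
    intro v hv
    have t1 : ¬ (G.Adj v a ∧ G.Adj v b) := fun h => ht _ _ _ h.1 ab h.2
    have t2 : ¬ (G.Adj v b ∧ G.Adj v c) := fun h => ht _ _ _ h.1 bc h.2
    have t3 : ¬ (G.Adj v c ∧ G.Adj v d) := fun h => ht _ _ _ h.1 cd h.2
    have x1 : ¬ (G.Adj v a ∧ ¬ G.Adj v c ∧ G.Adj v d) := by
      rintro ⟨h1, h2, h3⟩
      apply h5 ![a, b, c, d, v]
      intro i
      fin_cases i
      · exact ab
      · exact bc
      · exact cd
      · exact h3.symm
      · exact h1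
    have x2 : ¬ (G.Adj v a ∧ ¬ G.Adj v b ∧ ¬ G.Adj v c ∧ ¬ G.Adj v d) := by
      rintro ⟨h1, h2, h3, h4⟩
      exact hp v a b c d h1 ab bc cd h2 h3 h4 ac ad bd
    have x3 : ¬ (¬ G.Adj v a ∧ ¬ G.Adj v b ∧ ¬ G.Adj v c ∧ G.Adj v d) := by
      rintro ⟨h1, h2, h3, h4⟩
      exact hp v d c b a h4 (sy cd) (sy bc) (sy ab) h3 h2 h1 (ns bd) (ns ad) (ns ac)
    by_contra hcon
    push Not at hcon
    have y0 : ¬ (¬ G.Adj v a ∧ G.Adj v b ∧ ¬ G.Adj v c ∧ ¬ G.Adj v d) := hcon 0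
    have y1 : ¬ (G.Adj v a ∧ ¬ G.Adj v b ∧ G.Adj v c ∧ ¬ G.Adj v d) := hcon 1
    have y2 : ¬ (¬ G.Adj v a ∧ G.Adj v b ∧ ¬ G.Adj v c ∧ G.Adj v d) := hcon 2
    have y3 : ¬ (¬ G.Adj v a ∧ ¬ G.Adj v b ∧ G.Adj v c ∧ ¬ G.Adj v d) := hcon 3
    clear hcon
    by_cases A : G.Adj v a <;> by_cases B : G.Adj v b <;> by_cases C : G.Adj v c <;>
      by_cases D : G.Adj v d <;> simp only [A, B, C, D, not_true_eq_false, not_false_eq_true,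
        and_self, and_true, true_and, and_false, false_and, or_self] at *
  apply build T
  · apply propagate hG (fun v => ∃ j, T j v) a
    · exact nb a (Or.inr (Or.inl ab))
    · rintro u v huv ⟨i, hi⟩
      by_contra hv
      have q := fun h => hv (nb v h)
      simp only [imp_false, not_or] at q
      obtain ⟨qa, qb, qc, qd⟩ := q
      fin_cases i
      · obtain ⟨h1, h2, h3, h4⟩ := hi
        exact hp v u b c d (sy huv) h2 bc cd qb qc qd h3 h4 bd
      · obtain ⟨h1, h2, h3, h4⟩ := hi
        exact hA v u a b c d (sy huv) h1 h3 ab bc cd qb qd ad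
      · obtain ⟨h1, h2, h3, h4⟩ := hi
        exact hA v u d c b a (sy huv) h4 h2 (sy cd) (sy bc) (sy ab) qc qa (ns ad)
      · obtain ⟨h1, h2, h3, h4⟩ := hi
        exact hp v u c b a (sy huv) h3 (sy bc) (sy ab) qc qb qa h2 h1 (ns ac)
      · exact hi
  · have p01 : ∀ u v, T 0 u → T 1 v → G.Adj u v := by
      rintro u v ⟨h1, h2, h3, h4⟩ ⟨k1, k2, k3, k4⟩
      by_contra hne
      exact hA u b a v c d h2 (sy ab) bc (sy k1) k3 cd hne h4 ad
    have p12 : ∀ u v, T 1 u → T 2 v → G.Adj u v := by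
      rintro u v ⟨h1, h2, h3, h4⟩ ⟨k1, k2, k3, k4⟩
      by_contra hne
      exact hp u a b v d h1 ab (sy k2) k4 h2 hne h4 (ns k1) ad bd
    have p23 : ∀ u v, T 2 u → T 3 v → G.Adj u v := by
      rintro u v ⟨h1, h2, h3, h4⟩ ⟨k1, k2, k3, k4⟩
      by_contra hne
      exact hA v c d u b a k3 cd (sy bc) (sy h4) h2 (sy ab) (ns hne) k1 (ns ad)
    have p03 : ∀ u v, T 0 u → T 3 v → ¬ G.Adj u v := by
      rintro u v ⟨h1, h2, h3, h4⟩ ⟨k1, k2, k3, k4⟩ hne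
      exact hA a b u v c d ab (sy h2) bc hne k3 cd (ns k1) ad h4
    have cm : ∀ w u v, G.Adj u w → G.Adj v w → ¬ G.Adj u v :=
      fun w u v h1 h2 => ht _ _ _ h1 h2.symm
    have p00 : ∀ u v, T 0 u → T 0 v → ¬ G.Adj u v := fun u v h k => cm b u v h.2.1 k.2.1
    have p11 : ∀ u v, T 1 u → T 1 v → ¬ G.Adj u v := fun u v h k => cm a u v h.1 k.1
    have p22 : ∀ u v, T 2 u → T 2 v → ¬ G.Adj u v := fun u v h k => cm b u v h.2.1 k.2.1
    have p33 : ∀ u v, T 3 u → T 3 v → ¬ G.Adj u v := fun u v h k => cm c u v h.2.2.1 k.2.2.1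
    have p02 : ∀ u v, T 0 u → T 2 v → ¬ G.Adj u v := fun u v h k => cm b u v h.2.1 k.2.1
    have p13 : ∀ u v, T 1 u → T 3 v → ¬ G.Adj u v := fun u v h k => cm c u v h.2.2.1 k.2.2.1
    intro i j u v hu hv
    fin_cases i <;> fin_cases j <;> first
      | exact hu.elim
      | exact hv.elim
      | exact iff_of_true (p01 u v hu hv) (by decide)
      | exact iff_of_true (p12 u v hu hv) (by decide)
      | exact iff_of_true (p23 u v hu hv) (by decide)
      | exact iff_of_true (sy (p01 v u hv hu)) (by decide)
      | exact iff_of_true (sy (p12 v u hv hu)) (by decide)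
      | exact iff_of_true (sy (p23 v u hv hu)) (by decide)
      | exact iff_of_false (p00 u v hu hv) (by decide)
      | exact iff_of_false (p11 u v hu hv) (by decide)
      | exact iff_of_false (p22 u v hu hv) (by decide)
      | exact iff_of_false (p33 u v hu hv) (by decide)
      | exact iff_of_false (p02 u v hu hv) (by decide)
      | exact iff_of_false (p13 u v hu hv) (by decide)
      | exact iff_of_false (p03 u v hu hv) (by decide)
      | exact iff_of_false (ns (p02 v u hv hu)) (by decide)
      | exact iff_of_false (ns (p13 v u hv hu)) (by decide)
      | exact iff_of_false (ns (p03 v u hv hu)) (by decide)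

/-- The case of an edge, without induced four-vertex paths. -/
lemma case_edge (hG : G.Connected) (ht : NoTri G)
    (h4 : ∀ a b c d, G.Adj a b → G.Adj b c → G.Adj c d → G.Adj a d)
    (a b : V) (ab : G.Adj a b) :
    ∃ f, IsFullHom G (SimpleGraph.cycleGraph 5) f := by
  let T : Fin 5 → V → Prop := ![fun v => G.Adj v b, fun v => G.Adj v a,
    fun _ => False, fun _ => False, fun _ => False]
  apply build T
  · apply propagate hG (fun v => ∃ j, T j v) a
    · exact ⟨0, ab⟩
    · rintro u v huv ⟨i, hi⟩
      fin_cases i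
      · exact ⟨1, h4 v u b a huv.symm hi ab.symm⟩
      · exact ⟨0, h4 v u a b huv.symm hi ab⟩
      · exact hi.elim
      · exact hi.elim
      · exact hi.elim
  · intro i j u v hu hv
    fin_cases i <;> fin_cases j <;> first
      | exact hu.elim
      | exact hv.elim
      | exact iff_of_false (ht _ _ _ hu (G.adj_symm hv)) (by decide)
      | exact iff_of_true (h4 u b a v hu ab.symm (G.adj_symm hv)) (by decide)
      | exact iff_of_true (h4 u a b v hu ab (G.adj_symm hv)) (by decide)

lemma forward (hG : G.Connected) (ht : NoTri G) (hp : NoPFive G) (hA : NoA G) :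
    ∃ f, IsFullHom G (SimpleGraph.cycleGraph 5) f := by
  by_cases h5 : ∃ c : Fin 5 → V, ∀ i, G.Adj (c i) (c (i + 1))
  · obtain ⟨c, hc⟩ := h5
    exact case_five hG ht hp c hc
  by_cases h4 : ∀ a b c d, G.Adj a b → G.Adj b c → G.Adj c d → G.Adj a d
  · by_cases he : ∃ a b, G.Adj a b
    · obtain ⟨a, b, ab⟩ := he
      exact case_edge hG ht h4 a b ab
    · push Not at he
      exact ⟨fun _ => 0, fun u v => iff_of_false (he u v) (SimpleGraph.irrefl _)⟩
  · push Not at h4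
    obtain ⟨a, b, c, d, ab, bc, cd, ad⟩ := h4
    push Not at h5
    exact case_path hG ht hp hA (fun c => by simpa using h5 c) a b c d ab bc cd ad

lemma IsFullHom.comp' {U W : Type*} {F : SimpleGraph U} {H : SimpleGraph W} {f : U → V} {g : V → W}
    (hg : IsFullHom G H g) (hf : IsFullHom F G f) : IsFullHom F H (g ∘ f) :=
  fun u v => (hf u v).trans (hg _ _)

lemma c5_noTri : ∀ a b c : Fin 5, (SimpleGraph.cycleGraph 5).Adj a b →
    (SimpleGraph.cycleGraph 5).Adj b c → ¬ (SimpleGraph.cycleGraph 5).Adj a c := by decide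

lemma c5_path : ∀ a b : Fin 5, (SimpleGraph.cycleGraph 5).Adj a b →
    ∀ c, (SimpleGraph.cycleGraph 5).Adj b c → ∀ d, (SimpleGraph.cycleGraph 5).Adj c d →
    ¬ (SimpleGraph.cycleGraph 5).Adj a d →
    ∀ e, (SimpleGraph.cycleGraph 5).Adj d e →
    ¬ (SimpleGraph.cycleGraph 5).Adj b e → (SimpleGraph.cycleGraph 5).Adj a e := by decide

lemma c5_A : ∀ a b : Fin 5, (SimpleGraph.cycleGraph 5).Adj a b →
    ∀ e, (SimpleGraph.cycleGraph 5).Adj b e → ∀ f, (SimpleGraph.cycleGraph 5).Adj e f →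
    ¬ (SimpleGraph.cycleGraph 5).Adj a f →
    ∀ c, (SimpleGraph.cycleGraph 5).Adj b c → ¬ (SimpleGraph.cycleGraph 5).Adj c f →
    ∀ d, (SimpleGraph.cycleGraph 5).Adj c d →
    (SimpleGraph.cycleGraph 5).Adj d e → (SimpleGraph.cycleGraph 5).Adj a d := by decide

end helpers

/-- Homomorphism duality for full homomorphisms: a finite connected graph admits no
full homomorphism from any of C₃, P₄ (the path with 5 vertices) and A iff it admits
a full homomorphism into C₅. -/
theorem full_homomorphism_duality {V : Type*} [Fintype V] (G : SimpleGraph V)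
    (hG : G.Connected) :
    ((¬ ∃ f, IsFullHom (SimpleGraph.cycleGraph 3) G f) ∧
     (¬ ∃ f, IsFullHom (SimpleGraph.pathGraph 5) G f) ∧
     (¬ ∃ f, IsFullHom graphA G f)) ↔
    (∃ f, IsFullHom G (SimpleGraph.cycleGraph 5) f) := by
  constructor
  · rintro ⟨h3, hP, hA⟩
    have ht := noTri_of h3
    exact forward hG ht (noPFive_of hP) (noA_of ht hA)
  · rintro ⟨g, hg⟩
    refine ⟨?_, ?_, ?_⟩
    · rintro ⟨f, hf⟩
      have h := hg.comp' hf
      exact c5_noTri _ _ _ ((h 0 1).1 (by decide)) ((h 1 2).1 (by decide))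
        ((h 0 2).1 (by decide))
    · rintro ⟨f, hf⟩
      have h := hg.comp' hf
      simp only [IsFullHom, SimpleGraph.pathGraph_adj] at h
      have := c5_path _ _ ((h 0 1).1 (by decide)) _ ((h 1 2).1 (by decide)) _
        ((h 2 3).1 (by decide)) (fun k => absurd ((h 0 3).2 k) (by decide)) _
        ((h 3 4).1 (by decide)) (fun k => absurd ((h 1 4).2 k) (by decide))
      exact absurd ((h 0 4).2 this) (by decide)
    · rintro ⟨f, hf⟩
      have h := hg.comp' hf
      simp only [IsFullHom, graphA, SimpleGraph.fromRel_adj] at h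
      have := c5_A _ _ ((h 0 1).1 (by decide)) _ ((h 1 4).1 (by decide)) _
        ((h 4 5).1 (by decide)) (fun k => absurd ((h 0 5).2 k) (by decide)) _
        ((h 1 2).1 (by decide)) (fun k => absurd ((h 2 5).2 k) (by decide)) _
        ((h 2 3).1 (by decide)) ((h 3 4).1 (by decide))
      exact absurd ((h 0 3).2 this) (by decide)
end
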